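/- arXiv:1803.09011 — 4 statements merged into one kernel-verified Lean document; each statement's English description precedes it below -/
import Mathlib

section
/- Let K be a field of characteristic zero, N and m natural numbers, and Z an N×N alternating matrix over K with rank(Z) ≥ 2m. Then there exists a subset I of the index set with |I| = 2m such that the principal submatrix of Z with rows and columns indexed by I is invertible (equivalently, its Pfaffian is nonzero). -/
open Matrix

/-- The Pfaffian of a matrix (intended for `2m×2m` alternating matrices, with `m = n/2`):
`pf Z = (1/(2^m · m!)) · ∑_{σ ∈ Sym(2m)} sgn(σ) · ∏_{i=1}^{m} Z_{σ(2i−1), σ(2i)}`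
(written with 0-based indices). The Pfaffian of the empty matrix is `1`. -/
noncomputable def pf {R : Type*} [CommRing R] [Algebra ℚ R] {n : ℕ}
    (Z : Matrix (Fin n) (Fin n) R) : R :=
  ((2 ^ (n / 2) * Nat.factorial (n / 2) : ℚ))⁻¹ •
    ∑ σ : Equiv.Perm (Fin n), ((Equiv.Perm.sign σ : ℤ) : R) *
      ∏ i : Fin (n / 2),
        Z (σ ⟨2 * i, by have := i.isLt; omega⟩) (σ ⟨2 * i + 1, by have := i.isLt; omega⟩)

section Hyperbolic

variable {K : Type*} [Field K] {n : Type*} [Fintype n]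

theorem Matrix.rank_add_le_rank_add_rank (A B : Matrix n n K) :
    (A + B).rank ≤ A.rank + B.rank := by
  unfold Matrix.rank
  rw [Matrix.mulVecLin_add]
  refine (Submodule.finrank_mono ?_).trans (Submodule.finrank_add_le_finrank_add_finrank _ _)
  rintro _ ⟨x, rfl⟩
  exact Submodule.add_mem_sup ⟨x, rfl⟩ ⟨x, rfl⟩

/-- A skew-symmetric matrix of rank at least `2 * m` admits `m` mutually orthogonal
hyperbolic pairs. -/
theorem exists_hyperbolic_family [CharZero K] [DecidableEq n] (m : ℕ) (Z : Matrix n n K)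
    (hZ : Zᵀ = -Z) (hrank : 2 * m ≤ Z.rank) :
    ∃ v : Fin m × Fin 2 → n → K, ∀ a b, toBilin' Z (v a) (v b) =
      if a.1 = b.1 then !![(0 : K), 1; -1, 0] a.2 b.2 else 0 := by
  induction m generalizing Z with
  | zero => exact ⟨fun a => a.1.elim0, fun a => a.1.elim0⟩
  | succ m ih =>
    have skew : ∀ x y, toBilin' Z x y = -toBilin' Z y x := by
      intro x y
      rw [toBilin'_apply', toBilin'_apply', ← dotProduct_transpose_mulVec, hZ, neg_mulVec,
        dotProduct_neg]
    have self : ∀ x, toBilin' Z x x = 0 := fun x => self_eq_neg.mp (skew x x)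
    obtain ⟨x, y, hxy⟩ : ∃ x y, toBilin' Z x y = 1 := by
      by_contra! h
      have hz : Z = 0 := by
        ext i j
        by_contra hij
        refine h (Pi.single i 1) ((Z i j)⁻¹ • Pi.single j 1) ?_
        rw [map_smul, toBilin'_single, smul_eq_mul, inv_mul_cancel₀ hij]
      rw [hz, rank_zero] at hrank
      omega
    have hyx : toBilin' Z y x = -1 := by rw [skew, hxy]
    set p := Z *ᵥ x with hp
    set q := Z *ᵥ y with hq
    set Z' : Matrix n n K := Z + vecMulVec q p + vecMulVec (-p) q with hZ'
    have hskew' : Z'ᵀ = -Z' := by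
      ext i j
      have := congrFun (congrFun hZ i) j
      simp only [transpose_apply, Matrix.neg_apply] at this
      simp only [hZ', transpose_apply, Matrix.neg_apply, Matrix.add_apply, vecMulVec_apply, this, Pi.neg_apply]
      ring
    have hrank' : 2 * m ≤ Z'.rank := by
      have h : Z = Z' + vecMulVec (-q) p + vecMulVec p q := by
        ext i j
        simp only [hZ', Matrix.add_apply, vecMulVec_apply, Pi.neg_apply]
        ring
      have h1 := rank_add_le_rank_add_rank (Z' + vecMulVec (-q) p) (vecMulVec p q)
      have h2 := rank_add_le_rank_add_rank Z' (vecMulVec (-q) p)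
      have h3 := rank_vecMulVec_le (-q) p
      have h4 := rank_vecMulVec_le p q
      rw [← h] at h1
      omega
    obtain ⟨v, hv⟩ := ih Z' hskew' hrank'
    have hB' : ∀ u w, toBilin' Z' u w = toBilin' Z u w
        - toBilin' Z u y * toBilin' Z x w + toBilin' Z u x * toBilin' Z y w := by
      intro u w
      rw [skew x w, skew y w]
      simp only [toBilin'_apply', hZ', ← hp, ← hq, add_mulVec, dotProduct_add, vecMulVec_mulVec,
        dotProduct_smul, MulOpposite.smul_eq_mul_unop, MulOpposite.unop_op, dotProduct_neg,
        dotProduct_comm w]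
      ring
    let P : (n → K) → n → K := fun u => u - toBilin' Z u y • x + toBilin' Z u x • y
    have hP : ∀ u w, toBilin' Z (P u) (P w) = toBilin' Z' u w := by
      intro u w
      simp only [P, hB', map_add, map_sub, map_smul, LinearMap.add_apply, LinearMap.sub_apply,
        LinearMap.smul_apply, smul_eq_mul, self, hxy, hyx]
      rw [skew w x, skew w y]
      ring
    have hxP : ∀ u, toBilin' Z x (P u) = 0 := by
      intro u
      simp only [P, map_add, map_sub, map_smul, smul_eq_mul, self, hxy]
      rw [skew u x]
      ring
    have hyP : ∀ u, toBilin' Z y (P u) = 0 := by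
      intro u
      simp only [P, map_add, map_sub, map_smul, smul_eq_mul, self, hyx]
      rw [skew u y]
      ring
    have hPx : ∀ u, toBilin' Z (P u) x = 0 := fun u => by rw [skew, hxP, neg_zero]
    have hPy : ∀ u, toBilin' Z (P u) y = 0 := fun u => by rw [skew, hyP, neg_zero]
    refine ⟨fun a => Fin.cases (![x, y] a.2) (fun i => P (v (i, a.2))) a.1, ?_⟩
    rintro ⟨i, s⟩ ⟨j, t⟩
    induction i using Fin.cases <;> induction j using Fin.cases <;>
      fin_cases s <;> fin_cases t <;>
      simp [self, hxy, hyx, hxP, hyP, hPx, hPy, hP, hv, (Fin.succ_ne_zero _).symm]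

end Hyperbolic

section PairingForm

variable {K V : Type*} [CommRing K] [AddCommGroup V] [Module K V] {m : ℕ}

/-- The multilinear map `v ↦ ∏ i, B (v (i, 0)) (v (i, 1))`. -/
def pairingMultilinear (B : LinearMap.BilinForm K V) (m : ℕ) :
    MultilinearMap K (fun _ : Fin m × Fin 2 => V) K where
  toFun v := ∏ i, B (v (i, 0)) (v (i, 1))
  map_update_add' := by
    intro inst v a x y
    obtain rfl : inst = instDecidableEqProd := Subsingleton.elim _ _
    obtain ⟨i, s⟩ := a
    have h : ∀ z, ∏ j ∈ Finset.univ.erase i, B (Function.update v (i, s) z (j, 0))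
        (Function.update v (i, s) z (j, 1)) =
        ∏ j ∈ Finset.univ.erase i, B (v (j, 0)) (v (j, 1)) := by
      intro z
      refine Finset.prod_congr rfl fun j hj => ?_
      have hj : j ≠ i := Finset.ne_of_mem_erase hj
      simp [Function.update, hj]
    simp only [← Finset.mul_prod_erase _ _ (Finset.mem_univ i), h]
    fin_cases s <;> simp [Function.update, add_mul]
  map_update_smul' := by
    intro inst v a c x
    obtain rfl : inst = instDecidableEqProd := Subsingleton.elim _ _
    obtain ⟨i, s⟩ := a
    have h : ∀ z, ∏ j ∈ Finset.univ.erase i, B (Function.update v (i, s) z (j, 0))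
        (Function.update v (i, s) z (j, 1)) =
        ∏ j ∈ Finset.univ.erase i, B (v (j, 0)) (v (j, 1)) := by
      intro z
      refine Finset.prod_congr rfl fun j hj => ?_
      have hj : j ≠ i := Finset.ne_of_mem_erase hj
      simp [Function.update, hj]
    simp only [← Finset.mul_prod_erase _ _ (Finset.mem_univ i), h]
    fin_cases s <;> simp [Function.update, mul_assoc]

/-- The alternating form whose value on a family is a nonzero multiple of the Pfaffian of the
Gram matrix of that family. -/
def pairingForm (B : LinearMap.BilinForm K V) (m : ℕ) : V [⋀^Fin m × Fin 2]→ₗ[K] K :=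
  MultilinearMap.alternatization (pairingMultilinear B m)

theorem pairingForm_apply (B : LinearMap.BilinForm K V) (v : Fin m × Fin 2 → V) :
    pairingForm B m v = ∑ σ : Equiv.Perm (Fin m × Fin 2), ((Equiv.Perm.sign σ : ℤ) : K) *
      ∏ i, B (v (σ (i, 0))) (v (σ (i, 1))) := by
  rw [pairingForm, MultilinearMap.alternatization_apply]
  refine Finset.sum_congr rfl fun σ _ => ?_
  rw [Units.smul_def, zsmul_eq_mul]
  rfl

/-- A permutation of `Fin m × Fin 2` mapping blocks `{i} × Fin 2` to blocks contributes `1` to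
the Pfaffian of the standard symplectic matrix; all others contribute `0`. -/
theorem sign_mul_prod_hyperbolic (σ : Equiv.Perm (Fin m × Fin 2)) :
    ((Equiv.Perm.sign σ : ℤ) : K) * ∏ i, (if (σ (i, 0)).1 = (σ (i, 1)).1 then
      !![(0 : K), 1; -1, 0] (σ (i, 0)).2 (σ (i, 1)).2 else 0) =
    if ∀ i, (σ (i, 0)).1 = (σ (i, 1)).1 then 1 else 0 := by
  split_ifs with h
  · have hne : ∀ i, (σ (i, 0)).2 ≠ (σ (i, 1)).2 := by
      intro i hi
      have := σ.injective (Prod.ext (h i) hi)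
      simp at this
    have hex : ∀ i, ∃ ε : Equiv.Perm (Fin 2), ∀ s, (σ (i, s)).2 = ε s := by
      intro i
      have := hne i
      obtain h0 | h0 : (σ (i, 0)).2 = 0 ∨ (σ (i, 0)).2 = 1 := by omega
      · refine ⟨1, fun s => ?_⟩
        fin_cases s
        · simpa using h0
        · simp; omega
      · refine ⟨Equiv.swap 0 1, fun s => ?_⟩
        fin_cases s
        · simpa using h0
        · simp; omega
    choose ε hε using hex
    have hfst : ∀ i s, (σ (i, s)).1 = (σ (i, 0)).1 := by
      intro i s
      fin_cases s
      · rfl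
      · exact (h i).symm
    have hinj : Function.Injective fun i => (σ (i, 0)).1 := by
      intro i j hij
      obtain ⟨s, hs⟩ := (ε j).surjective (σ (i, 0)).2
      have : σ (i, 0) = σ (j, s) := by
        refine Prod.ext ?_ ?_
        · rw [hfst j s]; exact hij
        · rw [← hs, hε]
      exact congrArg Prod.fst (σ.injective this)
    let τ : Equiv.Perm (Fin m) := Equiv.ofBijective _ (Finite.injective_iff_bijective.mp hinj)
    have hσ : σ = Equiv.prodCongrLeft (fun _ => τ) * Equiv.prodCongrRight ε := by
      ext1 ⟨i, s⟩
      exact Prod.ext (hfst i s) (hε i s)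
    have hsign : Equiv.Perm.sign σ = ∏ i, Equiv.Perm.sign (ε i) := by
      rw [hσ, Equiv.Perm.sign_mul, Equiv.Perm.sign_prodCongrLeft, Equiv.Perm.sign_prodCongrRight]
      simp
    have hprod : ∀ i, !![(0 : K), 1; -1, 0] (ε i 0) (ε i 1) = ((Equiv.Perm.sign (ε i) : ℤ) : K) := by
      intro i
      generalize ε i = e
      have : e = 1 ∨ e = Equiv.swap 0 1 := by revert e; decide
      rcases this with rfl | rfl <;> simp
    rw [Finset.prod_congr rfl fun i _ => by rw [if_pos (h i), hε, hε, hprod], hsign,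
      Units.coe_prod, Int.cast_prod, ← Finset.prod_mul_distrib]
    refine Finset.prod_eq_one fun i _ => ?_
    rw [← Int.cast_mul, ← Units.val_mul, Int.units_mul_self, Units.val_one, Int.cast_one]
  · obtain ⟨i, hi⟩ := not_forall.mp h
    rw [Finset.prod_eq_zero (Finset.mem_univ i) (if_neg hi), mul_zero]

theorem pairingForm_hyperbolic_ne_zero [CharZero K] (B : LinearMap.BilinForm K V)
    (v : Fin m × Fin 2 → V) (hv : ∀ a b, B (v a) (v b) =
      if a.1 = b.1 then !![(0 : K), 1; -1, 0] a.2 b.2 else 0) :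
    pairingForm B m v ≠ 0 := by
  rw [pairingForm_apply]
  simp only [hv, sign_mul_prod_hyperbolic]
  rw [Finset.sum_boole, Nat.cast_ne_zero, Finset.card_ne_zero]
  exact ⟨1, by simp⟩

theorem pairingForm_eq_zero_of_mem_radical (B : LinearMap.BilinForm K V)
    (v : Fin m × Fin 2 → V) (a : Fin m × Fin 2) (hl : ∀ u, B (v a) u = 0)
    (hr : ∀ u, B u (v a) = 0) : pairingForm B m v = 0 := by
  rw [pairingForm_apply]
  refine Finset.sum_eq_zero fun σ _ => ?_
  obtain ⟨⟨i, s⟩, rfl⟩ := σ.surjective a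
  rw [Finset.prod_eq_zero (Finset.mem_univ i), mul_zero]
  fin_cases s
  · exact hl _
  · exact hr _

end PairingForm

section Pfaffian

variable {K : Type*} [Field K] [CharZero K] {m : ℕ}

/-- The bijection `(i, s) ↦ 2 * i + s`. -/
def pairEquiv (m : ℕ) : Fin m × Fin 2 ≃ Fin (2 * m) :=
  finProdFinEquiv.trans (finCongr (Nat.mul_comm m 2))

theorem pf_submatrix_ne_zero_iff {n : Type*} [Fintype n] [DecidableEq n] (Z : Matrix n n K)
    (g : Fin (2 * m) → n) :
    pf (Z.submatrix g g) ≠ 0 ↔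
      pairingForm (toBilin' Z) m (fun a => Pi.single (g (pairEquiv m a)) 1) ≠ 0 := by
  have hsum : pairingForm (toBilin' Z) m (fun a => Pi.single (g (pairEquiv m a)) 1) =
      ∑ σ : Equiv.Perm (Fin (2 * m)), ((Equiv.Perm.sign σ : ℤ) : K) *
      ∏ i : Fin (2 * m / 2), (Z.submatrix g g) (σ ⟨2 * i, by have := i.isLt; omega⟩)
        (σ ⟨2 * i + 1, by have := i.isLt; omega⟩) := by
    rw [pairingForm_apply]
    refine Fintype.sum_equiv (pairEquiv m).permCongr _ _ fun σ => ?_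
    rw [Equiv.Perm.sign_permCongr]
    congr 1
    refine Fintype.prod_equiv (finCongr (by omega)) _ _ fun i => ?_
    have h0 : (pairEquiv m).symm ⟨2 * i, by omega⟩ = (i, 0) := by
      rw [Equiv.symm_apply_eq]
      ext
      simp [pairEquiv]
    have h1 : (pairEquiv m).symm ⟨2 * i + 1, by omega⟩ = (i, 1) := by
      rw [Equiv.symm_apply_eq]
      ext
      simp [pairEquiv, add_comm]
    simp [toBilin'_single, Equiv.permCongr_apply, h0, h1]
  rw [hsum, pf, ne_eq, smul_eq_zero, not_or]
  exact and_iff_right (by positivity)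

theorem isUnit_of_pf_ne_zero (Z : Matrix (Fin (2 * m)) (Fin (2 * m)) K) (hZ : Zᵀ = -Z)
    (hpf : pf Z ≠ 0) : IsUnit Z := by
  rw [isUnit_iff_isUnit_det, isUnit_iff_ne_zero]
  intro hdet
  obtain ⟨w, hw, hZw⟩ := exists_mulVec_eq_zero_iff.mpr hdet
  obtain ⟨j, hj⟩ := Function.ne_iff.mp hw
  have hright : ∀ u, toBilin' Z u w = 0 := fun u => by
    rw [toBilin'_apply', hZw, dotProduct_zero]
  have hleft : ∀ u, toBilin' Z w u = 0 := fun u => by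
    rw [toBilin'_apply', ← dotProduct_transpose_mulVec, hZ, neg_mulVec, hZw, neg_zero,
      dotProduct_zero]
  have hne := (pf_submatrix_ne_zero_iff Z id).mp (by rwa [submatrix_id_id])
  set e : Fin m × Fin 2 → Fin (2 * m) → K := fun a => Pi.single (id (pairEquiv m a)) 1 with he
  obtain ⟨b, rfl⟩ := (pairEquiv m).surjective j
  have hsum : w = ∑ a, w (pairEquiv m a) • e a := by
    simp only [he, id]
    rw [(pairEquiv m).sum_comp fun i => w i • (Pi.single i 1 : Fin (2 * m) → K)]
    exact pi_eq_sum_univ' w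
  have hzero := pairingForm_eq_zero_of_mem_radical (toBilin' Z) (Function.update e b w) b
    (by simpa using hleft) (by simpa using hright)
  rw [hsum, AlternatingMap.map_update_sum, Finset.sum_eq_single b] at hzero
  · rw [AlternatingMap.map_update_smul, Function.update_eq_self, smul_eq_mul] at hzero
    exact mul_ne_zero hj hne hzero
  · intro a _ hab
    rw [AlternatingMap.map_update_smul, AlternatingMap.map_update_self _ _ hab.symm, smul_zero]
  · simp

end Pfaffian

/-- Let `Z` be an `N×N` alternating matrix over a field `K` of characteristic
zero with `rank(Z) ≥ 2m`. Then there is a subset `I` of the indices with `|I| = 2m` such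
that the principal submatrix of `Z` with rows and columns indexed by `I` is invertible
(equivalently, its Pfaffian is nonzero). -/
theorem exists_principal_submatrix_invertible {K : Type*} [Field K] [CharZero K]
    (N m : ℕ) (Z : Matrix (Fin N) (Fin N) K)
    (hAlt : Zᵀ = -Z ∧ ∀ i, Z i i = 0)
    (hrank : 2 * m ≤ Z.rank) :
    ∃ (I : Finset (Fin N)) (hI : I.card = 2 * m),
      IsUnit (Z.submatrix (fun i => (I.orderIsoOfFin hI i).1) (fun i => (I.orderIsoOfFin hI i).1))
        ∧
      pf (Z.submatrix (fun i => (I.orderIsoOfFin hI i).1) (fun i => (I.orderIsoOfFin hI i).1))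
        ≠ 0 := by
  obtain ⟨v, hv⟩ := exists_hyperbolic_family m Z hAlt.1 hrank
  have hform : pairingForm (toBilin' Z) m ≠ 0 := fun h =>
    pairingForm_hyperbolic_ne_zero _ v hv (by rw [h]; rfl)
  obtain ⟨f, hf, hne⟩ : ∃ f : Fin m × Fin 2 → Fin N, Function.Injective f ∧
      pairingForm (toBilin' Z) m (fun a => Pi.single (f a) 1) ≠ 0 := by
    by_contra! h
    refine hform (Module.Basis.ext_alternating (Pi.basisFun K (Fin N)) fun f hf => ?_)
    simpa using h f hf
  have hI : (Finset.univ.image f).card = 2 * m := by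
    rw [Finset.card_image_of_injective _ hf]
    simp [mul_comm]
  have hpf := (pf_submatrix_ne_zero_iff Z
    fun i => ((Finset.univ.image f).orderIsoOfFin hI i).1).mpr ?_
  · exact ⟨_, hI, isUnit_of_pf_ne_zero _ (by rw [transpose_submatrix, hAlt.1]; rfl) hpf, hpf⟩
  let e : Fin m × Fin 2 ≃ Finset.univ.image f :=
    (Equiv.ofInjective f hf).trans (Equiv.setCongr (by simp))
  let τ : Equiv.Perm (Fin m × Fin 2) :=
    ((pairEquiv m).trans ((Finset.univ.image f).orderIsoOfFin hI).toEquiv).trans e.symm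
  have hτ : ∀ a, f (τ a) = ((Finset.univ.image f).orderIsoOfFin hI (pairEquiv m a)).1 := fun a =>
    congrArg Subtype.val (e.apply_symm_apply _)
  have hperm := (pairingForm (toBilin' Z) m).map_perm (fun a => Pi.single (f a) 1) τ
  simp only [Function.comp_def, hτ] at hperm
  rw [hperm, Units.smul_def, zsmul_eq_mul]
  exact mul_ne_zero (by exact_mod_cast (Equiv.Perm.sign τ).ne_zero) hne
end

section
/- Let k ≥ 2 be an integer. Define the bilinear pairing on ℝ^{k+1} by ⟨(a, c₁,…,c_k), (d, u₁,…,u_k)⟩ = a·d − ∑_{i=1}^{k} c_i·u_i. For j = 0,…,k let N_j ∈ ℝ^{k+1} be the vector whose first coordinate is j+1, whose (1+h)-th coordinate is −(j−h+1) for 1 ≤ h ≤ j, and whose remaining coordinates are 0. Then the dual cone {w ∈ ℝ^{k+1} : ⟨N_j, w⟩ ≥ 0 for all j = 0,…,k} equals the cone generated by the following vectors: (1, −2, 1, 0, …, 0); for i = 1,…,k−2 the vector with first coordinate 0, entries 1, −2, 1 in coordinates 1+i, 2+i, 3+i, and 0 elsewhere; the vector (0, …, 0, 1, −2); and the vector (0,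 …, 0, 1). -/
/-- The vector `N_j ∈ ℝ^{k+1}`: first coordinate `j+1`, the `(1+h)`-th coordinate equal
to `−(j−h+1)` for `1 ≤ h ≤ j`, and `0` otherwise. -/
noncomputable def Nvec (k : ℕ) (j : Fin (k + 1)) : Fin (k + 1) → ℝ := fun i =>
  if (i : ℕ) = 0 then (j : ℕ) + 1
  else if (i : ℕ) ≤ (j : ℕ) then -(((j : ℕ) : ℝ) - ((i : ℕ) : ℝ) + 1)
  else 0

/-- The claimed generators of the dual cone: `(1, −2, 1, 0, …, 0)`; for `t = 1,…,k−2` the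
vector with first coordinate `0` and entries `1, −2, 1` in coordinates `1+t, 2+t, 3+t`;
the vector `(0, …, 0, 1, −2)`; and the vector `(0, …, 0, 1)`. -/
noncomputable def Gvec (k : ℕ) (t : Fin (k + 1)) : Fin (k + 1) → ℝ := fun i =>
  if (t : ℕ) = 0 then
    (if (i : ℕ) = 0 then 1 else if (i : ℕ) = 1 then -2 else if (i : ℕ) = 2 then 1 else 0)
  else if (t : ℕ) ≤ k - 2 then
    (if (i : ℕ) = (t : ℕ) then 1 else if (i : ℕ) = (t : ℕ) + 1 then -2
      else if (i : ℕ) = (t : ℕ) + 2 then 1 else 0)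
  else if (t : ℕ) = k - 1 then
    (if (i : ℕ) = k - 1 then 1 else if (i : ℕ) = k then -2 else 0)
  else
    (if (i : ℕ) = k then 1 else 0)

/-- The signed pairing with `N_j` is a weighted sum with the truncated weights `j + 1 - i`. -/
lemma Nvec_pairing (k : ℕ) (j : Fin (k + 1)) (w : Fin (k + 1) → ℝ) :
    Nvec k j 0 * w 0 - ∑ i : Fin k, Nvec k j i.succ * w i.succ
      = ∑ i : Fin (k + 1), (((j : ℕ) + 1 - (i : ℕ) : ℕ) : ℝ) * w i := by
  rw [Fin.sum_univ_succ, sub_eq_add_neg, ← Finset.sum_neg_distrib]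
  congr 1
  · simp [Nvec]
  · refine Finset.sum_congr rfl fun i _ => ?_
    simp only [Nvec, Fin.val_succ, Nat.succ_ne_zero, if_false]
    split_ifs with h
    · rw [Nat.cast_sub (by omega)]
      push_cast
      ring
    · rw [Nat.sub_eq_zero_of_le (by omega)]
      simp

/-- All generators are truncations of the second difference pattern `1, -2, 1`. -/
lemma Gvec_apply (k : ℕ) (hk : 2 ≤ k) (t i : Fin (k + 1)) :
    Gvec k t i = (if (i : ℕ) = t then 1 else 0) - 2 * (if (i : ℕ) = t + 1 then 1 else 0)
      + (if (i : ℕ) = t + 2 then 1 else 0) := by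
  have ht := t.isLt
  have hi := i.isLt
  unfold Gvec
  split_ifs <;> first | omega | norm_num

/-- A sum over `Fin n` against the indicator of `m`, for a weight vanishing from `n` on. -/
lemma sum_fin_mul_indicator (n m : ℕ) (f : ℕ → ℝ) (hf : n ≤ m → f m = 0) :
    ∑ i : Fin n, f i * (if (i : ℕ) = m then 1 else 0) = f m := by
  rw [Fin.sum_univ_eq_sum_range (fun i => f i * (if i = m then 1 else 0)) n]
  simp only [mul_ite, mul_one, mul_zero, Finset.sum_ite_eq', Finset.mem_range]
  split_ifs with h
  · rfl
  · exact (hf (not_lt.mp h)).symm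

/-- The nef classes and the generators are dual bases. -/
lemma weight_sum_Gvec (k : ℕ) (hk : 2 ≤ k) (j t : Fin (k + 1)) :
    ∑ i : Fin (k + 1), (((j : ℕ) + 1 - (i : ℕ) : ℕ) : ℝ) * Gvec k t i
      = if j = t then 1 else 0 := by
  have hj := j.isLt
  have key (m : ℕ) := sum_fin_mul_indicator (k + 1) m
    (fun i => (((j : ℕ) + 1 - i : ℕ) : ℝ))
    (fun h => by rw [Nat.sub_eq_zero_of_le (by omega), Nat.cast_zero])
  simp only [Gvec_apply k hk, mul_add, mul_sub, mul_left_comm _ (2 : ℝ),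
    Finset.sum_add_distrib, Finset.sum_sub_distrib, ← Finset.mul_sum, key]
  rcases lt_trichotomy (j : ℕ) t with h | h | h
  · rw [if_neg (by omega), Nat.sub_eq_zero_of_le (by omega), Nat.sub_eq_zero_of_le (by omega),
      Nat.sub_eq_zero_of_le (by omega)]
    norm_num
  · rw [if_pos (Fin.ext h), h, Nat.add_sub_cancel_left, Nat.sub_self,
      Nat.sub_eq_zero_of_le (by omega)]
    norm_num
  · rw [if_neg (by omega), Nat.cast_sub (by omega), Nat.cast_sub (by omega),
      Nat.cast_sub (by omega)]
    push_cast
    ring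

/-- With the pairing `⟨(a,c₁,…,c_k),(d,u₁,…,u_k)⟩ = a·d − ∑ c_i·u_i` on
`ℝ^{k+1}`, the dual cone of the vectors `N_0,…,N_k` equals the cone generated by the
vectors `Gvec k 0, …, Gvec k k`. -/
theorem dual_cone_of_nef_classes (k : ℕ) (hk : 2 ≤ k) :
    {w : Fin (k + 1) → ℝ |
        ∀ j : Fin (k + 1),
          0 ≤ Nvec k j 0 * w 0 - ∑ i : Fin k, Nvec k j i.succ * w i.succ}
      = {w : Fin (k + 1) → ℝ |
          ∃ c : Fin (k + 1) → ℝ, (∀ t, 0 ≤ c t) ∧ w = ∑ t, c t • Gvec k t} := by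
  let A : Matrix (Fin (k + 1)) (Fin (k + 1)) ℝ := fun j i => (((j : ℕ) + 1 - (i : ℕ) : ℕ) : ℝ)
  let B : Matrix (Fin (k + 1)) (Fin (k + 1)) ℝ := fun i t => Gvec k t i
  have hAB : A * B = 1 := by
    ext j t
    rw [Matrix.mul_apply, Matrix.one_apply]
    exact weight_sum_Gvec k hk j t
  have hBA : B * A = 1 := mul_eq_one_comm.mp hAB
  have hB (c : Fin (k + 1) → ℝ) : ∑ t, c t • Gvec k t = B.mulVec c := by
    ext i
    simp [B, Matrix.mulVec, dotProduct, mul_comm]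
  ext w
  simp only [Set.mem_ofPred_eq, Nvec_pairing, hB]
  change (∀ j, 0 ≤ A.mulVec w j) ↔ _
  constructor
  · intro h
    exact ⟨A.mulVec w, h, by rw [Matrix.mulVec_mulVec, hBA, Matrix.one_mulVec]⟩
  · rintro ⟨c, hc, rfl⟩
    rwa [Matrix.mulVec_mulVec, hAB, Matrix.one_mulVec]
end

section
/- In ℝ³, the cone generated by the four vectors (1,0,0), (2,−1,0), (3,−2,−1), (6,−3,−2) equals the union of the cone generated by (1,0,0), (2,−1,0), (3,−2,−1) and the cone generated by (1,0,0), (3,−2,−1), (6,−3,−2); moreover neither of the two sub-cones contains the other, and their intersection is the cone generated by (1,0,0) and (3,−2,−1). -/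
/-- The convex cone generated by finitely many vectors `v 0, …, v (s-1)` in `ℝ^d`: the set
of all nonnegative real linear combinations of them. -/
def coneOf {d s : ℕ} (v : Fin s → Fin d → ℝ) : Set (Fin d → ℝ) :=
  {w | ∃ c : Fin s → ℝ, (∀ i, 0 ≤ c i) ∧ w = ∑ i, c i • v i}

/-- The cone of `(1,0,0)`, `(2,−1,0)`, `(3,−2,−1)` in terms of its facet inequalities. -/
lemma mem_coneOf_nef_iff (w : Fin 3 → ℝ) :
    w ∈ coneOf (![![1,0,0], ![2,-1,0], ![3,-2,-1]] : Fin 3 → Fin 3 → ℝ) ↔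
      0 ≤ w 0 + 2 * w 1 - w 2 ∧ 0 ≤ 2 * w 2 - w 1 ∧ 0 ≤ -w 2 := by
  constructor
  · rintro ⟨c, hc, rfl⟩
    have h0 := hc 0
    have h1 := hc 1
    have h2 := hc 2
    simp [Fin.sum_univ_succ]
    refine ⟨?_, ?_, ?_⟩ <;> linarith
  · rintro ⟨h0, h1, h2⟩
    refine ⟨![w 0 + 2 * w 1 - w 2, 2 * w 2 - w 1, -w 2], ?_, ?_⟩
    · intro i
      fin_cases i <;> assumption
    · ext i
      fin_cases i <;> simp [Fin.sum_univ_succ] <;> ring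

/-- The cone of `(1,0,0)`, `(3,−2,−1)`, `(6,−3,−2)` in terms of its facet inequalities. -/
lemma mem_coneOf_flip_iff (w : Fin 3 → ℝ) :
    w ∈ coneOf (![![1,0,0], ![3,-2,-1], ![6,-3,-2]] : Fin 3 → Fin 3 → ℝ) ↔
      0 ≤ w 0 + 3 * w 2 ∧ 0 ≤ 3 * w 2 - 2 * w 1 ∧ 0 ≤ w 1 - 2 * w 2 := by
  constructor
  · rintro ⟨c, hc, rfl⟩
    have h0 := hc 0
    have h1 := hc 1
    have h2 := hc 2
    simp [Fin.sum_univ_succ]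
    refine ⟨?_, ?_, ?_⟩ <;> linarith
  · rintro ⟨h0, h1, h2⟩
    refine ⟨![w 0 + 3 * w 2, 3 * w 2 - 2 * w 1, w 1 - 2 * w 2], ?_, ?_⟩
    · intro i
      fin_cases i <;> assumption
    · ext i
      fin_cases i <;> simp [Fin.sum_univ_succ] <;> ring

/-- The cone of `(1,0,0)`, `(3,−2,−1)` in terms of linear equations and inequalities. -/
lemma mem_coneOf_wall_iff (w : Fin 3 → ℝ) :
    w ∈ coneOf (![![1,0,0], ![3,-2,-1]] : Fin 2 → Fin 3 → ℝ) ↔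
      0 ≤ w 0 + 3 * w 2 ∧ 0 ≤ -w 2 ∧ w 1 = 2 * w 2 := by
  constructor
  · rintro ⟨c, hc, rfl⟩
    have h0 := hc 0
    have h1 := hc 1
    simp [Fin.sum_univ_succ]
    refine ⟨?_, ?_, ?_⟩ <;> linarith
  · rintro ⟨h0, h1, h2⟩
    refine ⟨![w 0 + 3 * w 2, -w 2], ?_, ?_⟩
    · intro i
      fin_cases i <;> assumption
    · ext i
      fin_cases i <;> simp [Fin.sum_univ_succ] <;> linarith

/-- In `ℝ³`, `cone((1,0,0),(2,−1,0),(3,−2,−1),(6,−3,−2))` is the union of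
`cone((1,0,0),(2,−1,0),(3,−2,−1))` and `cone((1,0,0),(3,−2,−1),(6,−3,−2))`; neither of the
two sub-cones contains the other, and their intersection is `cone((1,0,0),(3,−2,−1))`. -/
theorem movable_cone_A7_decomposition :
    (coneOf (![![1,0,0], ![2,-1,0], ![3,-2,-1], ![6,-3,-2]] : Fin 4 → Fin 3 → ℝ)
      = coneOf (![![1,0,0], ![2,-1,0], ![3,-2,-1]] : Fin 3 → Fin 3 → ℝ) ∪
        coneOf (![![1,0,0], ![3,-2,-1], ![6,-3,-2]] : Fin 3 → Fin 3 → ℝ)) ∧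
    ¬ (coneOf (![![1,0,0], ![2,-1,0], ![3,-2,-1]] : Fin 3 → Fin 3 → ℝ) ⊆
        coneOf (![![1,0,0], ![3,-2,-1], ![6,-3,-2]] : Fin 3 → Fin 3 → ℝ)) ∧
    ¬ (coneOf (![![1,0,0], ![3,-2,-1], ![6,-3,-2]] : Fin 3 → Fin 3 → ℝ) ⊆
        coneOf (![![1,0,0], ![2,-1,0], ![3,-2,-1]] : Fin 3 → Fin 3 → ℝ)) ∧
    (coneOf (![![1,0,0], ![2,-1,0], ![3,-2,-1]] : Fin 3 → Fin 3 → ℝ) ∩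
        coneOf (![![1,0,0], ![3,-2,-1], ![6,-3,-2]] : Fin 3 → Fin 3 → ℝ)
      = coneOf (![![1,0,0], ![3,-2,-1]] : Fin 2 → Fin 3 → ℝ)) := by
  refine ⟨?_, fun h => ?_, fun h => ?_, ?_⟩
  · ext w
    rw [Set.mem_union, mem_coneOf_nef_iff, mem_coneOf_flip_iff]
    constructor
    · rintro ⟨c, hc, rfl⟩
      have h0 := hc 0
      have h1 := hc 1
      have h2 := hc 2
      have h3 := hc 3
      simp [Fin.sum_univ_succ]
      rcases le_total (c 3) (c 1) with h | h
      · left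
        refine ⟨?_, ?_, ?_⟩ <;> linarith
      · right
        refine ⟨?_, ?_, ?_⟩ <;> linarith
    · rintro (⟨h0, h1, h2⟩ | ⟨h0, h1, h2⟩)
      · refine ⟨![w 0 + 2 * w 1 - w 2, 2 * w 2 - w 1, -w 2, 0], ?_, ?_⟩
        · intro i
          fin_cases i
          exacts [h0, h1, h2, le_rfl]
        · ext i
          fin_cases i <;> simp [Fin.sum_univ_succ] <;> ring
      · refine ⟨![w 0 + 3 * w 2, 0, 3 * w 2 - 2 * w 1, w 1 - 2 * w 2], ?_, ?_⟩
        · intro i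
          fin_cases i
          exacts [h0, le_rfl, h1, h2]
        · ext i
          fin_cases i <;> simp [Fin.sum_univ_succ] <;> ring
  · have := (mem_coneOf_flip_iff _).1 (h ((mem_coneOf_nef_iff ![2,-1,0]).2 (by simp)))
    simp at this
    linarith
  · have := (mem_coneOf_nef_iff _).1 (h ((mem_coneOf_flip_iff ![6,-3,-2]).2 (by simp; norm_num)))
    simp at this
    linarith
  · ext w
    rw [Set.mem_inter_iff, mem_coneOf_nef_iff, mem_coneOf_flip_iff, mem_coneOf_wall_iff]
    constructor
    · rintro ⟨⟨h0, h1, h2⟩, h3, h4, h5⟩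
      refine ⟨?_, ?_, ?_⟩ <;> linarith
    · rintro ⟨h0, h1, h2⟩
      refine ⟨⟨?_, ?_, ?_⟩, ?_, ?_, ?_⟩ <;> linarith
end

section
/- In ℝ⁴, the cone generated by the five vectors (4,−3,−2,−1), (3,−2,−1,0), (1,0,0,0), (2,−1,0,0), (6,−3,−2,0) equals the union of the cone generated by (1,0,0,0), (4,−3,−2,−1), (2,−1,0,0), (3,−2,−1,0) and the cone generated by (1,0,0,0), (4,−3,−2,−1), (6,−3,−2,0), (3,−2,−1,0); moreover neither of the two sub-cones contains the other. -/
/-- Each generator lies in the cone it helps to generate. -/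
theorem mem_coneOf {d s : ℕ} (v : Fin s → Fin d → ℝ) (i : Fin s) : v i ∈ coneOf v := by
  refine ⟨Pi.single i 1, fun j => ?_, ?_⟩
  · by_cases h : j = i <;> simp [h]
  · simp [Pi.single_apply]

/-- In `ℝ⁴`, the cone generated by
`(4,−3,−2,−1), (3,−2,−1,0), (1,0,0,0), (2,−1,0,0), (6,−3,−2,0)` equals the union of
`cone((1,0,0,0),(4,−3,−2,−1),(2,−1,0,0),(3,−2,−1,0))` and
`cone((1,0,0,0),(4,−3,−2,−1),(6,−3,−2,0),(3,−2,−1,0))`, and neither of the two sub-cones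
contains the other. -/
theorem movable_cone_A8_decomposition :
    (coneOf (![![4,-3,-2,-1], ![3,-2,-1,0], ![1,0,0,0], ![2,-1,0,0], ![6,-3,-2,0]] :
        Fin 5 → Fin 4 → ℝ)
      = coneOf (![![1,0,0,0], ![4,-3,-2,-1], ![2,-1,0,0], ![3,-2,-1,0]] :
            Fin 4 → Fin 4 → ℝ) ∪
        coneOf (![![1,0,0,0], ![4,-3,-2,-1], ![6,-3,-2,0], ![3,-2,-1,0]] :
            Fin 4 → Fin 4 → ℝ)) ∧
    ¬ (coneOf (![![1,0,0,0], ![4,-3,-2,-1], ![2,-1,0,0], ![3,-2,-1,0]] :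
          Fin 4 → Fin 4 → ℝ) ⊆
        coneOf (![![1,0,0,0], ![4,-3,-2,-1], ![6,-3,-2,0], ![3,-2,-1,0]] :
          Fin 4 → Fin 4 → ℝ)) ∧
    ¬ (coneOf (![![1,0,0,0], ![4,-3,-2,-1], ![6,-3,-2,0], ![3,-2,-1,0]] :
          Fin 4 → Fin 4 → ℝ) ⊆
        coneOf (![![1,0,0,0], ![4,-3,-2,-1], ![2,-1,0,0], ![3,-2,-1,0]] :
          Fin 4 → Fin 4 → ℝ)) := by
  refine ⟨Set.Subset.antisymm ?_ (Set.union_subset ?_ ?_), fun h => ?_, fun h => ?_⟩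
  -- The relation `(2,−1,0,0) + (6,−3,−2,0) = 2 (3,−2,−1,0) + 2 (1,0,0,0)` eliminates whichever
  -- of the vectors `(2,−1,0,0)`, `(6,−3,−2,0)` has the smaller coefficient.
  · rintro w ⟨c, hc, rfl⟩
    have h0 := hc 0
    have h1 := hc 1
    have h2 := hc 2
    have h3 := hc 3
    have h4 := hc 4
    rcases le_total (c 4) (c 3) with h | h
    · refine Or.inl ⟨![c 2 + 2 * c 4, c 0, c 3 - c 4, c 1 + 2 * c 4], fun i => ?_, ?_⟩
      · fin_cases i <;> simp <;> linarith
      · ext j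
        fin_cases j <;> simp [Fin.sum_univ_succ] <;> ring
    · refine Or.inr ⟨![c 2 + 2 * c 3, c 0, c 4 - c 3, c 1 + 2 * c 3], fun i => ?_, ?_⟩
      · fin_cases i <;> simp <;> linarith
      · ext j
        fin_cases j <;> simp [Fin.sum_univ_succ] <;> ring
  · rintro w ⟨c, hc, rfl⟩
    refine ⟨![c 1, c 3, c 0, c 2, 0], fun i => ?_, ?_⟩
    · fin_cases i <;> simp [hc]
    · ext j
      fin_cases j <;> simp [Fin.sum_univ_succ] <;> ring
  · rintro w ⟨c, hc, rfl⟩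
    refine ⟨![c 1, c 3, c 0, 0, c 2], fun i => ?_, ?_⟩
    · fin_cases i <;> simp [hc]
    · ext j
      fin_cases j <;> simp [Fin.sum_univ_succ] <;> ring
  · obtain ⟨c, hc, hw⟩ := h (mem_coneOf _ 2)
    have e1 := congrFun hw 1
    have e2 := congrFun hw 2
    have e3 := congrFun hw 3
    simp [Fin.sum_univ_four] at e1 e2 e3
    linarith [hc 2, hc 3]
  · obtain ⟨c, hc, hw⟩ := h (mem_coneOf _ 2)
    have e1 := congrFun hw 1
    have e2 := congrFun hw 2
    have e3 := congrFun hw 3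
    simp [Fin.sum_univ_four] at e1 e2 e3
    linarith [hc 2]
end
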